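/- Let 𝔼 = ⟨ℰ, B⟩ be an epistemic space and ∘ an AGM revision operator for 𝔼 (satisfying (R1)–(R6)). Then ∘ is an extended credibility-limited revision operator for 𝔼 that is revision-compatible with some faithful credibility-limited assignment Ψ ↦ (⪯_Ψ, C_Ψ, b_Ψ) in which C_Ψ = Ω and b_Ψ = ⊥ for every Ψ ∈ ℰ. -/

import Mathlib

namespace CLR

/-- Propositional formulas over a signature `V` (with falsum `⊥` and implication;
other connectives are defined). -/
inductive Form (V : Type) : Type
  | atom : V → Form V
  | fls  : Form V
  | imp  : Form V → Form V → Form V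

namespace Form

variable {V : Type}

/-- Negation `¬φ := φ → ⊥`. -/
def neg (φ : Form V) : Form V := Form.imp φ Form.fls

/-- Verum `⊤ := ¬⊥`. -/
def tru : Form V := neg (Form.fls : Form V)

/-- Disjunction `φ ∨ ψ := ¬φ → ψ`. -/
def or' (φ ψ : Form V) : Form V := Form.imp (neg φ) ψ

/-- Conjunction `φ ∧ ψ := ¬(¬φ ∨ ¬ψ)`. -/
def and' (φ ψ : Form V) : Form V := neg (or' (neg φ) (neg ψ))

/-- Evaluation of a formula in an interpretation `w : V → Bool`. -/
def eval (w : V → Bool) : Form V → Bool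
  | atom v => w v
  | fls => false
  | imp φ ψ => !(eval w φ) || eval w ψ

end Form

/-- Interpretations (possible worlds) over signature `V`. -/
abbrev World (V : Type) := V → Bool

/-- The set of models `⟦φ⟧` of a formula. -/
def mods {V : Type} (φ : Form V) : Set (World V) := {w | φ.eval w = true}

/-- The set of models `⟦X⟧` of a set of formulas. -/
def modsSet {V : Type} (X : Set (Form V)) : Set (World V) :=
  {w | ∀ φ ∈ X, φ.eval w = true}

/-- Deductive closure (via semantic entailment, which is adequate for
classical propositional logic). -/
def Cn {V : Type} (X : Set (Form V)) : Set (Form V) :=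
  {φ | ∀ w ∈ modsSet X, w ∈ mods φ}

/-- Expansion: `X + α` is the deductive closure of `X ∪ {α}`. -/
def plus {V : Type} (X : Set (Form V)) (α : Form V) : Set (Form V) :=
  Cn (X ∪ {α})

/-- A formula is consistent if it has a model. -/
def FormConsistent {V : Type} (φ : Form V) : Prop := (mods φ).Nonempty

/-- A set of formulas is consistent if it has a model. -/
def SetConsistent {V : Type} (X : Set (Form V)) : Prop := (modsSet X).Nonempty

/-- An epistemic space `𝔼 = ⟨ℰ, B⟩`: each epistemic state `Ψ : E` has a
deductively closed belief set `B Ψ`. -/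
structure EpistemicSpace (V E : Type) where
  B : E → Set (Form V)
  closed : ∀ Ψ, B Ψ = Cn (B Ψ)

variable {V E : Type}

/-- Models `⟦Ψ⟧` of the belief set of an epistemic state. -/
def modsOf (ES : EpistemicSpace V E) (Ψ : E) : Set (World V) := modsSet (ES.B Ψ)

/-- (R1) `α ∈ B(Ψ∘α)`. -/
def R1 (ES : EpistemicSpace V E) (circ : E → Form V → E) : Prop :=
  ∀ Ψ α, α ∈ ES.B (circ Ψ α)

/-- (R2) `B(Ψ∘α) = B(Ψ)+α` whenever `B(Ψ)+α` is consistent. -/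
def R2 (ES : EpistemicSpace V E) (circ : E → Form V → E) : Prop :=
  ∀ Ψ α, SetConsistent (plus (ES.B Ψ) α) → ES.B (circ Ψ α) = plus (ES.B Ψ) α

/-- (R3) if `α` is consistent then `B(Ψ∘α)` is consistent. -/
def R3 (ES : EpistemicSpace V E) (circ : E → Form V → E) : Prop :=
  ∀ Ψ α, FormConsistent α → SetConsistent (ES.B (circ Ψ α))

/-- (R4) if `α ≡ β` then `B(Ψ∘α) = B(Ψ∘β)`. -/
def R4 (ES : EpistemicSpace V E) (circ : E → Form V → E) : Prop :=
  ∀ Ψ α β, mods α = mods β → ES.B (circ Ψ α) = ES.B (circ Ψ β)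

/-- (R5) `B(Ψ∘(α∧β)) ⊆ B(Ψ∘α)+β`. -/
def R5 (ES : EpistemicSpace V E) (circ : E → Form V → E) : Prop :=
  ∀ Ψ α β, ES.B (circ Ψ (Form.and' α β)) ⊆ plus (ES.B (circ Ψ α)) β

/-- (R6) if `B(Ψ∘α)+β` is consistent then `B(Ψ∘α)+β ⊆ B(Ψ∘(α∧β))`. -/
def R6 (ES : EpistemicSpace V E) (circ : E → Form V → E) : Prop :=
  ∀ Ψ α β, SetConsistent (plus (ES.B (circ Ψ α)) β) →
    plus (ES.B (circ Ψ α)) β ⊆ ES.B (circ Ψ (Form.and' α β))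

/-- AGM revision operator: satisfies (R1)–(R6). -/
def AGMRev (ES : EpistemicSpace V E) (circ : E → Form V → E) : Prop :=
  R1 ES circ ∧ R2 ES circ ∧ R3 ES circ ∧ R4 ES circ ∧ R5 ES circ ∧ R6 ES circ

/-- (CL1) `α ∈ B(Ψ∘α)` or `B(Ψ∘α) = B(Ψ)`. -/
def CL1 (ES : EpistemicSpace V E) (circ : E → Form V → E) : Prop :=
  ∀ Ψ α, α ∈ ES.B (circ Ψ α) ∨ ES.B (circ Ψ α) = ES.B Ψ

/-- (CL2) `B(Ψ∘α) = B(Ψ)+α` whenever `B(Ψ)+α` is consistent. -/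
def CL2 (ES : EpistemicSpace V E) (circ : E → Form V → E) : Prop :=
  ∀ Ψ α, SetConsistent (plus (ES.B Ψ) α) → ES.B (circ Ψ α) = plus (ES.B Ψ) α

/-- (CL3) `B(Ψ∘α)` is consistent. -/
def CL3 (ES : EpistemicSpace V E) (circ : E → Form V → E) : Prop :=
  ∀ Ψ α, SetConsistent (ES.B (circ Ψ α))

/-- (CL4) if `α ≡ β` then `B(Ψ∘α) = B(Ψ∘β)`. -/
def CL4 (ES : EpistemicSpace V E) (circ : E → Form V → E) : Prop :=
  ∀ Ψ α β, mods α = mods β → ES.B (circ Ψ α) = ES.B (circ Ψ β)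

/-- (CL5) if `α ∈ B(Ψ∘α)` and `α ⊨ β` then `β ∈ B(Ψ∘β)`. -/
def CL5 (ES : EpistemicSpace V E) (circ : E → Form V → E) : Prop :=
  ∀ Ψ α β, α ∈ ES.B (circ Ψ α) → mods α ⊆ mods β → β ∈ ES.B (circ Ψ β)

/-- (CL6) `B(Ψ∘(α∨β))` equals `B(Ψ∘α)`, or `B(Ψ∘β)`, or `B(Ψ∘α) ∩ B(Ψ∘β)`. -/
def CL6 (ES : EpistemicSpace V E) (circ : E → Form V → E) : Prop :=
  ∀ Ψ α β,
    ES.B (circ Ψ (Form.or' α β)) = ES.B (circ Ψ α) ∨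
    ES.B (circ Ψ (Form.or' α β)) = ES.B (circ Ψ β) ∨
    ES.B (circ Ψ (Form.or' α β)) = ES.B (circ Ψ α) ∩ ES.B (circ Ψ β)

/-- Credibility-limited revision operator: satisfies (CL1)–(CL6). -/
def CLRev (ES : EpistemicSpace V E) (circ : E → Form V → E) : Prop :=
  CL1 ES circ ∧ CL2 ES circ ∧ CL3 ES circ ∧ CL4 ES circ ∧ CL5 ES circ ∧ CL6 ES circ

/-- (ECL1) = (CL1). -/
def ECL1 (ES : EpistemicSpace V E) (circ : E → Form V → E) : Prop :=
  ∀ Ψ α, α ∈ ES.B (circ Ψ α) ∨ ES.B (circ Ψ α) = ES.B Ψ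

/-- (ECL2) = (CL2). -/
def ECL2 (ES : EpistemicSpace V E) (circ : E → Form V → E) : Prop :=
  ∀ Ψ α, SetConsistent (plus (ES.B Ψ) α) → ES.B (circ Ψ α) = plus (ES.B Ψ) α

/-- (ECL3) if `B(Ψ∘α)` is inconsistent then `B(Ψ)` or `α` is inconsistent. -/
def ECL3 (ES : EpistemicSpace V E) (circ : E → Form V → E) : Prop :=
  ∀ Ψ α, ¬ SetConsistent (ES.B (circ Ψ α)) →
    ¬ SetConsistent (ES.B Ψ) ∨ ¬ FormConsistent α

/-- (ECL4) if `B(Ψ∘α)` is consistent and `α ⊨ β` then `B(Ψ∘β)` is consistent. -/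
def ECL4 (ES : EpistemicSpace V E) (circ : E → Form V → E) : Prop :=
  ∀ Ψ α β, SetConsistent (ES.B (circ Ψ α)) → mods α ⊆ mods β →
    SetConsistent (ES.B (circ Ψ β))

/-- (ECL5) = (CL4). -/
def ECL5 (ES : EpistemicSpace V E) (circ : E → Form V → E) : Prop :=
  ∀ Ψ α β, mods α = mods β → ES.B (circ Ψ α) = ES.B (circ Ψ β)

/-- (ECL6) = (CL5). -/
def ECL6 (ES : EpistemicSpace V E) (circ : E → Form V → E) : Prop :=
  ∀ Ψ α β, α ∈ ES.B (circ Ψ α) → mods α ⊆ mods β → β ∈ ES.B (circ Ψ β)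

/-- (ECL7) = (CL6). -/
def ECL7 (ES : EpistemicSpace V E) (circ : E → Form V → E) : Prop :=
  ∀ Ψ α β,
    ES.B (circ Ψ (Form.or' α β)) = ES.B (circ Ψ α) ∨
    ES.B (circ Ψ (Form.or' α β)) = ES.B (circ Ψ β) ∨
    ES.B (circ Ψ (Form.or' α β)) = ES.B (circ Ψ α) ∩ ES.B (circ Ψ β)

/-- Extended credibility-limited revision operator: satisfies (ECL1)–(ECL7). -/
def ECLRev (ES : EpistemicSpace V E) (circ : E → Form V → E) : Prop :=
  ECL1 ES circ ∧ ECL2 ES circ ∧ ECL3 ES circ ∧ ECL4 ES circ ∧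
    ECL5 ES circ ∧ ECL6 ES circ ∧ ECL7 ES circ

/-- `min(X,⪯) = {ω ∈ X : ω ⪯ ω' for all ω' ∈ X}`. -/
def minSet {W : Type} (X : Set W) (le : W → W → Prop) : Set W :=
  {ω ∈ X | ∀ ω' ∈ X, le ω ω'}

/-- The data of a credibility-limited assignment `Ψ ↦ (⪯_Ψ, C_Ψ, b_Ψ)`
(with `b_Ψ = ⊤` rendered as `true`, `b_Ψ = ⊥` as `false`). -/
structure CLAssignment (V E : Type) where
  le : E → World V → World V → Prop
  C : E → Set (World V)
  b : E → Bool

/-- `A` is a credibility-limited assignment for `ES`: `⟦Ψ⟧ ⊆ C_Ψ`,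
`⪯_Ψ` is a total preorder on `C_Ψ`, and (CLA⊥): if `b_Ψ = ⊥` then `C_Ψ = Ω`. -/
def IsCLAssignment (ES : EpistemicSpace V E) (A : CLAssignment V E) : Prop :=
  (∀ Ψ, modsOf ES Ψ ⊆ A.C Ψ) ∧
  (∀ Ψ, ∀ ω₁ ∈ A.C Ψ, ∀ ω₂ ∈ A.C Ψ, A.le Ψ ω₁ ω₂ ∨ A.le Ψ ω₂ ω₁) ∧
  (∀ Ψ, ∀ ω₁ ∈ A.C Ψ, ∀ ω₂ ∈ A.C Ψ, ∀ ω₃ ∈ A.C Ψ,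
      A.le Ψ ω₁ ω₂ → A.le Ψ ω₂ ω₃ → A.le Ψ ω₁ ω₃) ∧
  (∀ Ψ, A.b Ψ = false → A.C Ψ = Set.univ)

/-- Faithfulness: (CLFA1) and (CLFA2). -/
def Faithful (ES : EpistemicSpace V E) (A : CLAssignment V E) : Prop :=
  (∀ (Ψ : E) (ω₁ ω₂ : World V), ω₁ ∈ modsOf ES Ψ → ω₂ ∈ modsOf ES Ψ →
      A.le Ψ ω₁ ω₂ ∧ A.le Ψ ω₂ ω₁) ∧
  (∀ (Ψ : E) (ω₁ ω₂ : World V), ω₁ ∈ modsOf ES Ψ → ω₂ ∉ modsOf ES Ψ →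
      A.le Ψ ω₁ ω₂ ∧ ¬ A.le Ψ ω₂ ω₁)

/-- Revision-compatibility of an assignment with a belief change operator:
`⟦Ψ∘α⟧ = min(⟦α⟧,⪯_Ψ)` if `⟦α⟧ ∩ C_Ψ ≠ ∅`; `⟦Ψ∘α⟧ = ∅` if `⟦α⟧ = ∅` and
`b_Ψ = ⊥`; and `⟦Ψ∘α⟧ = ⟦Ψ⟧` otherwise. -/
def RevCompatible (ES : EpistemicSpace V E) (circ : E → Form V → E)
    (A : CLAssignment V E) : Prop :=
  ∀ Ψ α,
    ((mods α ∩ A.C Ψ).Nonempty →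
      modsOf ES (circ Ψ α) = minSet (mods α) (A.le Ψ)) ∧
    (mods α = ∅ → A.b Ψ = false → modsOf ES (circ Ψ α) = ∅) ∧
    (¬ (mods α ∩ A.C Ψ).Nonempty → ¬ (mods α = ∅ ∧ A.b Ψ = false) →
      modsOf ES (circ Ψ α) = modsOf ES Ψ)


theorem Form.eval_and' (w : World V) (φ ψ : Form V) :
    (Form.and' φ ψ).eval w = (φ.eval w && ψ.eval w) := by
  simp only [Form.and', Form.or', Form.neg, Form.eval]
  cases φ.eval w <;> cases ψ.eval w <;> rfl

theorem mods_and' (φ ψ : Form V) : mods (Form.and' φ ψ) = mods φ ∩ mods ψ := by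
  ext w
  simp [mods, Form.eval_and']

theorem mods_or' (φ ψ : Form V) : mods (Form.or' φ ψ) = mods φ ∪ mods ψ := by
  ext w
  simp only [mods, Form.or', Form.neg, Form.eval, Set.mem_union, Set.mem_ofPred_eq]
  cases φ.eval w <;> cases ψ.eval w <;> simp

/-- Agreement with a given world on finitely many atoms is definable. -/
theorem exists_mods_eq_agree (w : World V) (s : Finset V) :
    ∃ φ : Form V, mods φ = {u | ∀ v ∈ s, u v = w v} := by
  classical
  induction s using Finset.induction_on with
  | empty => exact ⟨Form.tru, by ext u; simp [mods, Form.tru, Form.neg, Form.eval]⟩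
  | insert a s _ ih =>
    obtain ⟨φ, hφ⟩ := ih
    obtain ⟨χ, hχ⟩ : ∃ χ : Form V, mods χ = {u | u a = w a} := by
      cases hw : w a
      · exact ⟨Form.neg (Form.atom a), by ext u; simp [mods, Form.neg, Form.eval]⟩
      · exact ⟨Form.atom a, rfl⟩
    refine ⟨Form.and' χ φ, ?_⟩
    rw [mods_and', hφ, hχ]
    ext u
    simp

/-- Over a finite signature every set of worlds is the set of models of a formula. -/
theorem exists_mods_eq [Finite V] (S : Set (World V)) : ∃ φ : Form V, mods φ = S := by
  have := Fintype.ofFinite V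
  induction S, S.toFinite using Set.Finite.induction_on with
  | empty => exact ⟨Form.fls, by ext u; simp [mods, Form.eval]⟩
  | @insert w S _ _ ih =>
    obtain ⟨φ, hφ⟩ := ih
    obtain ⟨χ, hχ⟩ := exists_mods_eq_agree w Finset.univ
    refine ⟨Form.or' χ φ, ?_⟩
    rw [mods_or', hφ, hχ]
    ext u
    simp [funext_iff]

theorem modsSet_Cn (X : Set (Form V)) : modsSet (Cn X) = modsSet X :=
  Set.Subset.antisymm (fun _ hw φ hφ => hw φ fun _ hu => hu φ hφ) fun _ hw _ hφ => hφ _ hw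

theorem modsSet_plus (X : Set (Form V)) (α : Form V) :
    modsSet (plus X α) = modsSet X ∩ mods α := by
  rw [plus, modsSet_Cn]
  ext w
  simp only [modsSet, mods, Set.mem_ofPred_eq, Set.mem_inter_iff, Set.mem_union,
    Set.mem_singleton_iff]
  exact ⟨fun h => ⟨fun φ hφ => h φ (.inl hφ), h α (.inr rfl)⟩,
    fun h φ hφ => hφ.elim (h.1 φ) fun e => e ▸ h.2⟩

theorem modsSet_anti {X Y : Set (Form V)} (h : X ⊆ Y) : modsSet Y ⊆ modsSet X :=
  fun _ hw φ hφ => hw φ (h hφ)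

theorem mem_B_iff (ES : EpistemicSpace V E) (Ψ : E) (φ : Form V) :
    φ ∈ ES.B Ψ ↔ modsOf ES Ψ ⊆ mods φ := by
  conv_lhs => rw [ES.closed Ψ]
  rfl

/-- A choice function on sets picking nonempty subsets of nonempty sets and satisfying
Arrow's axiom. -/
structure IsArrowChoice {W : Type} (M : Set W → Set W) : Prop where
  subset : ∀ S, M S ⊆ S
  nonempty : ∀ S, S.Nonempty → (M S).Nonempty
  restrict : ∀ S T, S ⊆ T → (M T ∩ S).Nonempty → M S = M T ∩ S

namespace IsArrowChoice

variable {W : Type} {M : Set W → Set W}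

theorem mem_pair_of_mem (hM : IsArrowChoice M) {S : Set W} {a b : W} (ha : a ∈ M S)
    (hb : b ∈ S) : a ∈ M {a, b} := by
  have hsub : ({a, b} : Set W) ⊆ S := Set.pair_subset (hM.subset _ ha) hb
  rw [hM.restrict _ _ hsub ⟨a, ha, by simp⟩]
  exact ⟨ha, by simp⟩

theorem mem_of_mem_pair (hM : IsArrowChoice M) {S : Set W} {a b : W} (haS : a ∈ S)
    (hb : b ∈ M S) (hab : a ∈ M {a, b}) : a ∈ M S := by
  have hsub : ({a, b} : Set W) ⊆ S := Set.pair_subset haS (hM.subset _ hb)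
  rw [hM.restrict _ _ hsub ⟨b, hb, by simp⟩] at hab
  exact hab.1

theorem total (hM : IsArrowChoice M) (a b : W) : a ∈ M {a, b} ∨ b ∈ M {b, a} := by
  obtain ⟨x, hx⟩ := hM.nonempty {a, b} ⟨a, by simp⟩
  rcases hM.subset _ hx with rfl | rfl
  · exact .inl hx
  · exact .inr (Set.pair_comm a x ▸ hx)

theorem trans (hM : IsArrowChoice M) {a b c : W} (hab : a ∈ M {a, b}) (hbc : b ∈ M {b, c}) :
    a ∈ M {a, c} := by
  have key : b ∈ M {a, b, c} → a ∈ M {a, b, c} := fun hb =>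
    hM.mem_of_mem_pair (by simp) hb hab
  suffices ha : a ∈ M {a, b, c} from hM.mem_pair_of_mem ha (by simp)
  obtain ⟨x, hx⟩ := hM.nonempty {a, b, c} ⟨a, by simp⟩
  rcases hM.subset _ hx with rfl | rfl | rfl
  · exact hx
  · exact key hx
  · exact key (hM.mem_of_mem_pair (by simp) hx hbc)

theorem eq_minSet (hM : IsArrowChoice M) {S : Set W} (hS : S.Nonempty) :
    M S = minSet S fun a b => a ∈ M {a, b} := by
  ext a
  refine ⟨fun ha => ⟨hM.subset _ ha, fun b hb => hM.mem_pair_of_mem ha hb⟩, fun ha => ?_⟩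
  obtain ⟨x, hx⟩ := hM.nonempty S hS
  exact hM.mem_of_mem_pair ha.1 hx (ha.2 x (hM.subset _ hx))

end IsArrowChoice

namespace AGMRev

variable {ES : EpistemicSpace V E} {circ : E → Form V → E}

theorem modsOf_subset (h : AGMRev ES circ) (Ψ : E) (α : Form V) :
    modsOf ES (circ Ψ α) ⊆ mods α :=
  (mem_B_iff ES _ α).1 (h.1 Ψ α)

theorem modsOf_congr (h : AGMRev ES circ) (Ψ : E) {α β : Form V} (hαβ : mods α = mods β) :
    modsOf ES (circ Ψ α) = modsOf ES (circ Ψ β) :=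
  congrArg modsSet (h.2.2.2.1 Ψ α β hαβ)

theorem modsOf_eq_inter (h : AGMRev ES circ) (Ψ : E) (α : Form V)
    (hα : (modsOf ES Ψ ∩ mods α).Nonempty) :
    modsOf ES (circ Ψ α) = modsOf ES Ψ ∩ mods α := by
  rw [modsOf, h.2.1 Ψ α (by rwa [SetConsistent, modsSet_plus]), modsSet_plus, modsOf]

theorem modsOf_restrict (h : AGMRev ES circ) (Ψ : E) {α β : Form V} (hαβ : mods α ⊆ mods β)
    (hne : (modsOf ES (circ Ψ β) ∩ mods α).Nonempty) :
    modsOf ES (circ Ψ α) = modsOf ES (circ Ψ β) ∩ mods α := by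
  have hand : mods α = mods (Form.and' β α) := by
    rw [mods_and', Set.inter_eq_right.2 hαβ]
  have hcon : SetConsistent (plus (ES.B (circ Ψ β)) α) := by
    rwa [SetConsistent, modsSet_plus]
  have h5 := modsSet_anti (h.2.2.2.2.1 Ψ β α)
  have h6 := modsSet_anti (h.2.2.2.2.2 Ψ β α hcon)
  rw [modsSet_plus] at h5 h6
  rw [h.modsOf_congr Ψ hand]
  exact h6.antisymm h5

theorem ecl7 (h : AGMRev ES circ) : ECL7 ES circ := by
  intro Ψ α β
  have hor := mods_or' α β
  have hα : mods α ⊆ mods (Form.or' α β) := hor ▸ Set.subset_union_left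
  have hβ : mods β ⊆ mods (Form.or' α β) := hor ▸ Set.subset_union_right
  have hsub := h.modsOf_subset Ψ (Form.or' α β)
  have hsplit : modsOf ES (circ Ψ (Form.or' α β)) =
      modsOf ES (circ Ψ (Form.or' α β)) ∩ mods α ∪
        modsOf ES (circ Ψ (Form.or' α β)) ∩ mods β := by
    rw [← Set.inter_union_distrib_left, ← hor, Set.inter_eq_left.2 hsub]
  by_cases h₁ : (modsOf ES (circ Ψ (Form.or' α β)) ∩ mods α).Nonempty <;>
    by_cases h₂ : (modsOf ES (circ Ψ (Form.or' α β)) ∩ mods β).Nonempty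
  · rw [← h.modsOf_restrict Ψ hα h₁, ← h.modsOf_restrict Ψ hβ h₂] at hsplit
    refine .inr (.inr (Set.ext fun φ => ?_))
    rw [Set.mem_inter_iff, mem_B_iff, mem_B_iff, mem_B_iff, hsplit, Set.union_subset_iff]
  · rw [Set.not_nonempty_iff_eq_empty.1 h₂, Set.union_empty,
      ← h.modsOf_restrict Ψ hα h₁] at hsplit
    exact .inl (Set.ext fun φ => by rw [mem_B_iff, mem_B_iff, hsplit])
  · rw [Set.not_nonempty_iff_eq_empty.1 h₁, Set.empty_union,
      ← h.modsOf_restrict Ψ hβ h₂] at hsplit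
    exact .inr (.inl (Set.ext fun φ => by rw [mem_B_iff, mem_B_iff, hsplit]))
  · rw [Set.not_nonempty_iff_eq_empty.1 h₁, Set.not_nonempty_iff_eq_empty.1 h₂,
      Set.union_empty] at hsplit
    have hempty : mods (Form.or' α β) = ∅ := by
      by_contra hne
      have := h.2.2.1 Ψ _ (Set.nonempty_iff_ne_empty.2 hne)
      exact this.ne_empty hsplit
    refine .inl (h.2.2.2.1 Ψ _ _ ?_)
    rw [hempty, Set.subset_empty_iff.1 (hα.trans hempty.subset)]

theorem eclRev (h : AGMRev ES circ) : ECLRev ES circ :=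
  ⟨fun Ψ α => .inl (h.1 Ψ α), h.2.1, fun Ψ α hn => .inr fun hα => hn (h.2.2.1 Ψ α hα),
    fun Ψ α β hc hαβ => h.2.2.1 Ψ β (hc.mono ((h.modsOf_subset Ψ α).trans hαβ)),
    h.2.2.2.1, fun Ψ _ β _ _ => h.1 Ψ β, h.ecl7⟩

end AGMRev

/-- Every AGM revision operator is an extended credibility-limited
revision operator which is revision-compatible with some faithful
credibility-limited assignment in which `C_Ψ = Ω` and `b_Ψ = ⊥` for all `Ψ`. -/
theorem stmt8 {V E : Type} [Nonempty V] [Fintype V] [Nonempty E]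
    (ES : EpistemicSpace V E) (circ : E → Form V → E)
    (h : AGMRev ES circ) :
    ECLRev ES circ ∧
      ∃ A : CLAssignment V E,
        IsCLAssignment ES A ∧ Faithful ES A ∧ RevCompatible ES circ A ∧
        (∀ Ψ : E, A.C Ψ = Set.univ) ∧ (∀ Ψ : E, A.b Ψ = false) := by
  refine ⟨h.eclRev, ?_⟩
  choose F hF using exists_mods_eq (V := V)
  have hM : ∀ Ψ, IsArrowChoice fun S => modsOf ES (circ Ψ (F S)) := fun Ψ =>
    { subset := fun S => by simpa only [hF] using h.modsOf_subset Ψ (F S)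
      nonempty := fun S hS => h.2.2.1 Ψ (F S) (by rwa [FormConsistent, hF])
      restrict := fun S T hST hne => by
        have := h.modsOf_restrict Ψ (α := F S) (β := F T) (by rwa [hF, hF])
        rw [hF] at this
        exact this hne }
  have hinter : ∀ Ψ S, (modsOf ES Ψ ∩ S).Nonempty →
      modsOf ES (circ Ψ (F S)) = modsOf ES Ψ ∩ S := fun Ψ S hS => by
    have := h.modsOf_eq_inter Ψ (F S)
    rw [hF] at this
    exact this hS
  refine ⟨⟨fun Ψ a b => a ∈ modsOf ES (circ Ψ (F {a, b})), fun _ => Set.univ, fun _ => false⟩,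
    ⟨fun _ => Set.subset_univ _, fun Ψ a _ b _ => (hM Ψ).total a b,
      fun Ψ _ _ _ _ _ _ => (hM Ψ).trans, fun _ _ => rfl⟩, ⟨?_, ?_⟩, ?_, fun _ => rfl,
    fun _ => rfl⟩
  · intro Ψ a b ha hb
    constructor
    · dsimp only
      rw [hinter Ψ {a, b} ⟨a, ha, by simp⟩]
      exact ⟨ha, by simp⟩
    · dsimp only
      rw [hinter Ψ {b, a} ⟨a, ha, by simp⟩]
      exact ⟨hb, by simp⟩
  · intro Ψ a b ha hb
    constructor
    · dsimp only
      rw [hinter Ψ {a, b} ⟨a, ha, by simp⟩]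
      exact ⟨ha, by simp⟩
    · dsimp only
      rw [hinter Ψ {b, a} ⟨a, ha, by simp⟩]
      exact fun hmem => hb hmem.1
  · refine fun Ψ α => ⟨fun hα => ?_, fun hα _ => ?_, fun hn hne => ?_⟩
    · rw [h.modsOf_congr Ψ (hF (mods α)).symm]
      exact (hM Ψ).eq_minSet (hα.mono Set.inter_subset_left)
    · exact Set.subset_empty_iff.1 (hα ▸ h.modsOf_subset Ψ α)
    · rw [Set.inter_univ, Set.not_nonempty_iff_eq_empty] at hn
      exact absurd ⟨hn, rfl⟩ hne

end CLR
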